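/- For every sufficiently large integer N, ∫_{−1/2}^{1/2} |S̃(α) − 1/z|² dα = (N/2) log N + O(N (log N)^{1/2}), where z = 1/N − 2πiα, with an absolute implied constant. (This statement is unconditional.) -/

import Mathlib

open Finset

/-- The von Mangoldt function. -/
noncomputable def vM (n : ℕ) : ℝ := ArithmeticFunction.vonMangoldt n

/-- `z = 1/N - 2πiα`. -/
noncomputable def zOf (N : ℕ) (α : ℝ) : ℂ :=
  1 / (N : ℂ) - 2 * (Real.pi : ℂ) * Complex.I * (α : ℂ)

/-- The weighted exponential sum `S̃(α) = ∑_{n ≥ 1} Λ(n) e^{-n/N} e(nα)`. -/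
noncomputable def Stilde (N : ℕ) (α : ℝ) : ℂ :=
  ∑' n : ℕ, (vM n : ℂ) * Real.exp (-(n : ℝ) / N) *
    Complex.exp (2 * (Real.pi : ℂ) * Complex.I * (n : ℂ) * (α : ℂ))

/-- The Mellin-type integral `∫₁^∞ {x} x^{-s-1} dx`. -/
noncomputable def fractMellin (s : ℂ) : ℂ :=
  ∫ t in Set.Ioi (1 : ℝ), ((Int.fract t : ℝ) : ℂ) * (t : ℂ) ^ (-(s + 1))

lemma integrableOn_fract_mul_cpow {s : ℂ} (hs : 0 < s.re) :
    MeasureTheory.IntegrableOn (fun t : ℝ => ((Int.fract t : ℝ) : ℂ) * (t : ℂ) ^ (-(s + 1)))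
      (Set.Ioi 1) := by
  have h := integrableOn_Ioi_cpow_of_lt (a := -(s+1)) (c := 1) (by simp; linarith) one_pos
  refine h.bdd_mul (c := 1) ?_ ?_
  · exact (Complex.measurable_ofReal.comp measurable_fract).aestronglyMeasurable
  · refine Filter.Eventually.of_forall fun t => ?_
    rw [Complex.norm_real, Real.norm_eq_abs, Int.abs_fract]
    exact (Int.fract_lt_one t).le

lemma norm_fractMellin_le {s : ℂ} (hs : 0 < s.re) : ‖fractMellin s‖ ≤ 1 / s.re := by
  have h1 : ∫ t in Set.Ioi (1 : ℝ), t ^ (-(s.re + 1)) = 1 / s.re := by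
    rw [integral_Ioi_rpow_of_lt (by linarith) one_pos]
    simp
  rw [← h1, fractMellin]
  refine MeasureTheory.norm_integral_le_of_norm_le
    (integrableOn_Ioi_rpow_of_lt (by linarith) one_pos) ?_
  refine (MeasureTheory.ae_restrict_iff' measurableSet_Ioi).2 (Filter.Eventually.of_forall ?_)
  intro t ht
  have ht0 : (0 : ℝ) < t := lt_trans one_pos ht
  rw [norm_mul, Complex.norm_real, Real.norm_eq_abs, Int.abs_fract,
    Complex.norm_cpow_eq_rpow_re_of_pos ht0]
  have : (-(s + 1)).re = -(s.re + 1) := by simp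
  rw [this]
  exact mul_le_of_le_one_left (Real.rpow_nonneg ht0.le _) (Int.fract_lt_one t).le

lemma differentiableAt_fractMellin {s : ℂ} (hs : 0 < s.re) :
    DifferentiableAt ℂ fractMellin s := by
  let f : ℝ → ℂ := (Set.Ioi (1 : ℝ)).indicator fun t => ((Int.fract t : ℝ) : ℂ)
  have hf1 : ∀ t, ‖f t‖ ≤ 1 := by
    intro t
    refine (norm_indicator_le_norm_self _ _).trans ?_
    rw [Complex.norm_real, Real.norm_eq_abs, Int.abs_fract]
    exact (Int.fract_lt_one t).le
  have hfm : MeasureTheory.AEStronglyMeasurable f :=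
    ((Complex.measurable_ofReal.comp measurable_fract).indicator
      measurableSet_Ioi).aestronglyMeasurable
  have heq : fractMellin = fun s => mellin f (-s) := by
    funext s
    rw [fractMellin, mellin]
    have : ∀ t : ℝ, (t : ℂ) ^ (-s - 1) • f t = (Set.Ioi (1 : ℝ)).indicator
        (fun t : ℝ => ((Int.fract t : ℝ) : ℂ) * (t : ℂ) ^ (-(s + 1))) t := by
      intro t
      by_cases ht : t ∈ Set.Ioi (1 : ℝ)
      · simp only [f, Set.indicator_of_mem ht, smul_eq_mul]
        rw [mul_comm]; congr 2; ring
      · simp only [f, Set.indicator_of_notMem ht, smul_zero]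
    simp_rw [this]
    rw [MeasureTheory.setIntegral_indicator measurableSet_Ioi]
    congr 2
    rw [Set.inter_eq_right.2]
    exact Set.Ioi_subset_Ioi zero_le_one
  rw [heq]
  have hloc : MeasureTheory.LocallyIntegrableOn f (Set.Ioi 0) := by
    refine MeasureTheory.LocallyIntegrable.locallyIntegrableOn ?_ _
    exact (MeasureTheory.locallyIntegrable_const (1 : ℝ)).mono hfm
      (Filter.Eventually.of_forall fun t => by simpa using hf1 t)
  have := mellin_differentiableAt_of_isBigO_rpow (a := 0) (b := -s.re - 1) (s := -s) hloc ?_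
    (by simpa using hs) ?_ (by simp)
  · exact this.comp s differentiableAt_id.neg
  · simp only [neg_zero, Real.rpow_zero]
    exact Asymptotics.IsBigO.of_bound 1 (Filter.Eventually.of_forall fun t => by simpa using hf1 t)
  · refine Asymptotics.IsBigO.of_bound 1 ?_
    have : Set.Iio (1 : ℝ) ∈ nhdsWithin (0 : ℝ) (Set.Ioi 0) :=
      nhdsWithin_le_nhds (Iio_mem_nhds one_pos)
    filter_upwards [this] with t ht
    have : f t = 0 := Set.indicator_of_notMem (by simp at ht ⊢; linarith) _
    rw [this]; simp

lemma riemannZeta_eq_fractMellin {s : ℂ} (hs : 1 < s.re) :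
    riemannZeta s = 1 + 1 / (s - 1) - s * fractMellin s := by
  have hs1 : s ≠ 1 := by rintro rfl; simp at hs
  have hs1' : s - 1 ≠ 0 := sub_ne_zero.2 hs1
  have h := LSeries_eq_mul_integral (fun _ => (1 : ℂ)) zero_le_one (s := s) hs
    (by simpa using! LSeriesSummable_one_iff.2 hs) (by
      refine Asymptotics.IsBigO.of_bound 1 (Filter.Eventually.of_forall fun n => ?_)
      simp)
  have h0 : LSeries (fun _ => (1 : ℂ)) s = riemannZeta s := by
    simpa using! LSeries_one_eq_riemannZeta hs
  rw [← h0, h]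
  have hI : ∫ t in Set.Ioi (1 : ℝ), (t : ℂ) ^ (-s) = 1 / (s - 1) := by
    rw [integral_Ioi_cpow_of_lt (by simpa using hs) one_pos]
    simp
    rw [← neg_div_neg_eq, div_eq_mul_inv]
    simp
    ring
  have hint1 : MeasureTheory.IntegrableOn (fun t : ℝ => (t : ℂ) ^ (-s)) (Set.Ioi 1) :=
    integrableOn_Ioi_cpow_of_lt (by simpa using hs) one_pos
  have : ∫ t in Set.Ioi (1 : ℝ), (∑ k ∈ Icc 1 ⌊t⌋₊, (1 : ℂ)) * (t : ℂ) ^ (-(s + 1)) =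
      1 / (s - 1) - fractMellin s := by
    rw [← hI, fractMellin, ← MeasureTheory.integral_sub hint1
      (integrableOn_fract_mul_cpow (by linarith))]
    refine MeasureTheory.setIntegral_congr_fun measurableSet_Ioi fun t ht => ?_
    have ht0 : (0 : ℝ) < t := lt_trans one_pos ht
    have htc : (t : ℂ) ≠ 0 := by exact_mod_cast ht0.ne'
    have e1 : (t : ℂ) ^ (-s) = t * (t : ℂ) ^ (-(s + 1)) := by
      rw [show -s = 1 + -(s + 1) by ring, Complex.cpow_add _ _ htc, Complex.cpow_one]
    simp only [sum_const, Nat.card_Icc, Nat.add_sub_cancel]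
    rw [e1, ← sub_mul, nsmul_eq_mul, mul_one]
    congr 1
    have : (⌊t⌋₊ : ℝ) = t - Int.fract t := by
      rw [Int.self_sub_fract, natCast_floor_eq_intCast_floor ht0.le]
    rw [← Complex.ofReal_natCast, this, Complex.ofReal_sub]
  rw [this]
  field_simp
  ring

lemma riemannZeta₀_eq_fractMellin {s : ℂ} (hs : 0 < s.re) :
    riemannZeta₀ s = 1 - s * fractMellin s := by
  let U : Set ℂ := {s | 0 < s.re}
  have hU : IsOpen U := isOpen_lt continuous_const Complex.continuous_re
  have hUc : IsPreconnected U := (convex_halfSpace_re_gt 0).isPreconnected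
  have h1 : AnalyticOnNhd ℂ riemannZeta₀ U :=
    differentiable_riemannZeta₀.differentiableOn.analyticOnNhd hU
  have h2 : AnalyticOnNhd ℂ (fun s => 1 - s * fractMellin s) U := by
    refine DifferentiableOn.analyticOnNhd (fun s hs => ?_) hU
    have := differentiableAt_fractMellin (s := s) hs
    exact DifferentiableAt.differentiableWithinAt (by fun_prop)
  refine h1.eqOn_of_preconnected_of_eventuallyEq h2 hUc (z₀ := 2) (by simp [U]) ?_ hs
  have : {s : ℂ | 1 < s.re} ∈ nhds (2 : ℂ) :=
    (isOpen_lt continuous_const Complex.continuous_re).mem_nhds (by simp)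
  filter_upwards [this] with w hw
  have hw1 : w ≠ 1 := by rintro rfl; simp at hw
  have := riemannZeta_eq_inv_sub_add hw1
  rw [riemannZeta_eq_fractMellin hw] at this
  linear_combination (exp := 1) -this

/-- `f` is `O((1 + |Im s|)^k)` on the strip `a ≤ Re s ≤ b`. -/
def StripBound (f : ℂ → ℂ) (a b : ℝ) (k : ℕ) : Prop :=
  ∃ A : ℝ, 0 < A ∧ ∀ s : ℂ, a ≤ s.re → s.re ≤ b → ‖f s‖ ≤ A * (1 + |s.im|) ^ k

lemma StripBound.deriv {f : ℂ → ℂ} (hf : Differentiable ℂ f) {a b r : ℝ} {k : ℕ} (hr : 0 < r)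
    (h : StripBound f a b k) : StripBound (deriv f) (a + r) (b - r) k := by
  obtain ⟨A, hA, h⟩ := h
  refine ⟨A * (1 + r) ^ k / r, by positivity, fun s h1 h2 => ?_⟩
  have := Complex.norm_deriv_le_of_forall_mem_sphere_norm_le (c := s) (C := A * ((1 + r) * (1 + |s.im|)) ^ k)
    hr hf.diffContOnCl (fun w hw => ?_)
  · refine this.trans (le_of_eq ?_)
    rw [mul_pow]; ring
  · have hw' : ‖w - s‖ = r := by simpa [dist_eq_norm] using hw
    have hre := Complex.abs_re_le_norm (w - s)
    have him := Complex.abs_im_le_norm (w - s)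
    rw [hw'] at hre him
    simp only [Complex.sub_re, Complex.sub_im] at hre him
    have := abs_le.1 hre
    refine (h w (by linarith) (by linarith)).trans ?_
    gcongr
    have h3 : |w.im| ≤ |s.im| + r := by
      have := abs_add_le (s.im) (w.im - s.im)
      rw [add_sub_cancel] at this; linarith
    nlinarith [abs_nonneg s.im]

lemma stripBound_riemannZeta₀ : StripBound riemannZeta₀ (1/2) 4 1 := by
  refine ⟨10, by norm_num, fun s h1 h2 => ?_⟩
  have h0 : 0 < s.re := by linarith
  rw [riemannZeta₀_eq_fractMellin h0]
  have hb : ‖fractMellin s‖ ≤ 2 := (norm_fractMellin_le h0).trans (by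
    rw [div_le_iff₀ h0]; linarith)
  have hs : ‖s‖ ≤ 4 + |s.im| := by
    refine (Complex.norm_le_abs_re_add_abs_im s).trans ?_
    rw [abs_of_pos h0]; linarith
  calc ‖1 - s * fractMellin s‖ ≤ 1 + ‖s‖ * ‖fractMellin s‖ := by
        refine (norm_sub_le _ _).trans ?_
        rw [norm_mul, norm_one]
    _ ≤ 1 + (4 + |s.im|) * 2 := by gcongr
    _ ≤ _ := by nlinarith [abs_nonneg s.im]

lemma stripBound_riemannZeta₁ : StripBound riemannZeta₁ (1/2) 4 2 := by
  obtain ⟨A, hA, h⟩ := stripBound_riemannZeta₀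
  refine ⟨1 + 4 * A, by positivity, fun s h1 h2 => ?_⟩
  have h3 := h s h1 h2
  have hs : ‖s - 1‖ ≤ 3 + |s.im| := by
    refine (Complex.norm_le_abs_re_add_abs_im _).trans ?_
    simp only [Complex.sub_re, Complex.one_re, Complex.sub_im, Complex.one_im, sub_zero]
    gcongr
    rw [abs_le]; constructor <;> linarith
  have ht := abs_nonneg s.im
  calc ‖riemannZeta₁ s‖ ≤ 1 + ‖s - 1‖ * ‖riemannZeta₀ s‖ := by
        rw [riemannZeta₁]
        refine (norm_add_le _ _).trans ?_
        rw [norm_mul, norm_one]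
    _ ≤ 1 + (3 + |s.im|) * (A * (1 + |s.im|) ^ 1) := by gcongr
    _ ≤ 1 * (1 + |s.im|) ^ 2 + (4 * (1 + |s.im|)) * (A * (1 + |s.im|) ^ 1) := by
        gcongr
        · rw [one_mul]; exact one_le_pow₀ (by linarith)
        · linarith
    _ = _ := by ring

lemma one_le_norm_riemannZeta₁_product {x : ℝ} (hx : 0 < x) {y : ℝ} (hy : 1 ≤ |y|) :
    x ^ 3 ≤ ‖riemannZeta₁ (1 + x)‖ ^ 3 * ‖riemannZeta₁ (1 + x + Complex.I * y)‖ ^ 4 *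
      ‖riemannZeta₁ (1 + x + 2 * Complex.I * y)‖ := by
  have h := DirichletCharacter.norm_LFunction_product_ge_one (N := 1) 1 hx y
  rw [DirichletCharacter.LFunctionTrivChar] at h
  simp only [DirichletCharacter.LFunction_modOne_eq] at h
  have n1 : (1 + x : ℂ) ≠ 1 := fun h => by
    have := congrArg Complex.re h
    simp at this
    exact hx.ne' this
  have n2 : (1 + x + Complex.I * y : ℂ) ≠ 1 := fun h => by
    have := congrArg Complex.re h
    simp at this
    exact hx.ne' this
  have n3 : (1 + x + 2 * Complex.I * y : ℂ) ≠ 1 := fun h => by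
    have := congrArg Complex.re h
    simp at this
    exact hx.ne' this
  rw [riemannZeta_eq_inv_sub_mul n1, riemannZeta_eq_inv_sub_mul n2,
    riemannZeta_eq_inv_sub_mul n3] at h
  simp only [norm_mul, norm_pow, norm_inv] at h
  have m1 : ‖(1 + x - 1 : ℂ)‖ = x := by
    rw [add_sub_cancel_left, Complex.norm_real, Real.norm_of_nonneg hx.le]
  have m2 : 1 ≤ ‖(1 + x + Complex.I * y - 1 : ℂ)‖ := by
    refine hy.trans (le_trans (le_of_eq ?_) (Complex.abs_im_le_norm _))
    simp
  have m3 : 1 ≤ ‖(1 + x + 2 * Complex.I * y - 1 : ℂ)‖ := by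
    have : |y| ≤ |(1 + x + 2 * Complex.I * y - 1 : ℂ).im| := by
      simp [abs_mul]; linarith
    exact hy.trans (this.trans (Complex.abs_im_le_norm _))
  rw [m1] at h
  have k2 := inv_le_one_of_one_le₀ m2
  have k3 := inv_le_one_of_one_le₀ m3
  have i2 : 0 ≤ ‖(1 + x + Complex.I * y - 1 : ℂ)‖⁻¹ := by positivity
  set a := ‖riemannZeta₁ (1 + x)‖
  set b := ‖riemannZeta₁ (1 + x + Complex.I * y)‖
  set c := ‖riemannZeta₁ (1 + x + 2 * Complex.I * y)‖
  have : 1 ≤ (x⁻¹ * a) ^ 3 * (1 * b) ^ 4 * (1 * c) := by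
    refine le_trans h ?_
    gcongr
  calc x ^ 3 = x ^ 3 * 1 := by ring
    _ ≤ x ^ 3 * ((x⁻¹ * a) ^ 3 * (1 * b) ^ 4 * (1 * c)) := by gcongr
    _ = _ := by field_simp

lemma exists_riemannZeta₁_lower_bound_of_one_le_im :
    ∃ c : ℝ, 0 < c ∧ ∀ s : ℂ, 1 < s.re → s.re ≤ 2 → 1 ≤ |s.im| →
      c ≤ ‖riemannZeta₁ s‖ * (1 + |s.im|) ^ 8 := by
  obtain ⟨A, hA, h⟩ := stripBound_riemannZeta₁
  obtain ⟨B, hB, hd⟩ := stripBound_riemannZeta₁.deriv differentiable_riemannZeta₁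
    (r := 1/2) (by norm_num)
  -- lower bound away from the line
  have key : ∀ x : ℝ, 0 < x → x ≤ 1 → ∀ y : ℝ, 1 ≤ |y| →
      x ^ 3 ≤ 4 * A ^ 4 * ‖riemannZeta₁ (1 + x + Complex.I * y)‖ ^ 4 * (1 + |y|) ^ 2 := by
    intro x hx hx1 y hy
    refine (one_le_norm_riemannZeta₁_product hx hy).trans ?_
    have e1 := h (1 + x) (by simp; linarith) (by simp; linarith)
    have e2 := h (1 + x + 2 * Complex.I * y) (by simp; linarith) (by simp; linarith)
    simp only [Complex.add_im, Complex.one_im, Complex.ofReal_im, add_zero, abs_zero, one_pow,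
      mul_one] at e1
    have e3 : |(1 + x + 2 * Complex.I * y : ℂ).im| = 2 * |y| := by simp [abs_mul]
    rw [e3] at e2
    have e4 : ‖riemannZeta₁ (1 + x + 2 * Complex.I * y)‖ ≤ A * (2 * (1 + |y|)) ^ 2 := by
      refine e2.trans ?_
      gcongr
      linarith
    calc _ ≤ A ^ 3 * ‖riemannZeta₁ (1 + x + Complex.I * y)‖ ^ 4 * (A * (2 * (1 + |y|)) ^ 2) := by
          gcongr
      _ = _ := by ring
  set κ : ℝ := min 1 (1 / (64 * A ^ 4 * B ^ 4)) with hκ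
  have hκ0 : 0 < κ := by positivity
  have hκ1 : κ ≤ 1 := min_le_left _ _
  have hκ2 : κ * (64 * A ^ 4 * B ^ 4) ≤ 1 := by
    have := min_le_right 1 (1 / (64 * A ^ 4 * B ^ 4))
    rwa [← hκ, le_div_iff₀ (by positivity)] at this
  refine ⟨B * κ, by positivity, fun s h1 h2 h3 => ?_⟩
  set τ := 1 + |s.im| with hτ
  have hτ1 : 1 ≤ τ := by linarith
  have hτ0 : 0 < τ := by linarith
  set δ := κ / τ ^ 10 with hδ
  have hδ0 : 0 < δ := by positivity
  have hδ1 : δ ≤ 1 := (div_le_one (by positivity)).2 (hκ1.trans (one_le_pow₀ hτ1))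
  -- lower bound at distance at least `δ`
  have far : ∀ x : ℝ, δ ≤ x → x ≤ 1 →
      2 * B * τ ^ 2 * δ ≤ ‖riemannZeta₁ (1 + x + Complex.I * s.im)‖ := by
    intro x hx hx1
    have k := key x (hδ0.trans_le hx) hx1 s.im h3
    refine le_of_pow_le_pow_left₀ (n := 4) (by norm_num) (norm_nonneg _) ?_
    have h4 : δ ^ 3 ≤ x ^ 3 := by gcongr
    have h5 : (2 * B * τ ^ 2 * δ) ^ 4 * (4 * A ^ 4 * τ ^ 2) ≤ δ ^ 3 := by
      have : (2 * B * τ ^ 2 * δ) ^ 4 * (4 * A ^ 4 * τ ^ 2) =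
          (κ * (64 * A ^ 4 * B ^ 4)) * δ ^ 3 := by
        rw [hδ]; field_simp; ring
      rw [this]
      exact mul_le_of_le_one_left (by positivity) hκ2
    refine le_of_mul_le_mul_right (a := 4 * A ^ 4 * τ ^ 2) ?_ (by positivity)
    calc _ ≤ δ ^ 3 := h5
      _ ≤ x ^ 3 := h4
      _ ≤ _ := k
      _ = _ := by ring
  have hgoal : B * κ = B * τ ^ 2 * δ * τ ^ 8 := by rw [hδ]; field_simp
  rw [hgoal]
  refine mul_le_mul_of_nonneg_right ?_ (by positivity)
  have hs : s = 1 + ((s.re - 1 : ℝ) : ℂ) + Complex.I * s.im := by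
    apply Complex.ext <;> simp
  rcases le_total δ (s.re - 1) with hc | hc
  · have := far (s.re - 1) hc (by linarith)
    rw [← hs] at this
    have hp : 0 ≤ B * τ ^ 2 * δ := by positivity
    linarith
  · have k := far δ le_rfl hδ1
    set w : ℂ := 1 + δ + Complex.I * s.im with hw
    let S : Set ℂ := {z | z.re ∈ Set.Icc 1 2} ∩ {z | z.im = s.im}
    have hconv : Convex ℝ S := by
      refine Convex.inter ?_ ?_
      · exact (convex_Icc (1 : ℝ) 2).linear_preimage Complex.reLm
      · exact (convex_singleton s.im).linear_preimage Complex.imLm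
    have := hconv.norm_image_sub_le_of_norm_deriv_le (f := riemannZeta₁) (x := s) (y := w)
      (C := B * τ ^ 2)
      (fun z _ => differentiable_riemannZeta₁ z) (fun z hz => ?_)
      ⟨⟨h1.le, h2⟩, rfl⟩ ⟨⟨by simp [hw]; linarith, by simp [hw]; linarith⟩, by simp [hw]⟩
    · have hws : ‖w - s‖ ≤ δ := by
        have : w - s = ((δ - (s.re - 1) : ℝ) : ℂ) := by
          apply Complex.ext <;> simp [hw]; ring
        rw [this, Complex.norm_real, Real.norm_eq_abs, abs_le]
        constructor <;> linarith
      have h6 : ‖riemannZeta₁ w - riemannZeta₁ s‖ ≤ B * τ ^ 2 * δ :=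
        this.trans (by gcongr)
      have h7 : ‖riemannZeta₁ w‖ ≤ ‖riemannZeta₁ w - riemannZeta₁ s‖ + ‖riemannZeta₁ s‖ := by
        simpa using norm_add_le (riemannZeta₁ w - riemannZeta₁ s) (riemannZeta₁ s)
      linarith
    · have hz2 : z.im = s.im := hz.2
      have := hd z (by linarith [hz.1.1]) (by linarith [hz.1.2])
      rwa [hz2] at this

lemma riemannZeta₁_ne_zero {s : ℂ} (hs : 1 ≤ s.re) : riemannZeta₁ s ≠ 0 := by
  rcases eq_or_ne s 1 with rfl | h
  · simp
  · intro h0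
    have := riemannZeta_eq_inv_sub_mul h
    rw [h0, mul_zero] at this
    exact riemannZeta_ne_zero_of_one_le_re hs this

lemma exists_norm_inv_riemannZeta₁_le :
    ∃ A : ℝ, 0 < A ∧ ∀ s : ℂ, 1 < s.re → s.re ≤ 2 →
      ‖(riemannZeta₁ s)⁻¹‖ ≤ A * (1 + |s.im|) ^ 8 := by
  obtain ⟨c, hc, h⟩ := exists_riemannZeta₁_lower_bound_of_one_le_im
  obtain ⟨M, hM⟩ := (isCompact_Icc.reProdIm isCompact_Icc :
      IsCompact (Set.Icc (1:ℝ) 2 ×ℂ Set.Icc (-1:ℝ) 1)).exists_bound_of_continuousOn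
    (f := fun s => (riemannZeta₁ s)⁻¹)
    (differentiable_riemannZeta₁.continuous.continuousOn.inv₀ fun s hs =>
      riemannZeta₁_ne_zero hs.1.1)
  refine ⟨c⁻¹ + |M|, by positivity, fun s h1 h2 => ?_⟩
  have hτ : 1 ≤ (1 + |s.im|) ^ 8 := one_le_pow₀ (by linarith [abs_nonneg s.im])
  rcases le_total 1 |s.im| with h3 | h3
  · have h4 := h s h1 h2 h3
    have h5 : 0 < ‖riemannZeta₁ s‖ := norm_pos_iff.2 (riemannZeta₁_ne_zero h1.le)
    rw [norm_inv, inv_le_iff_one_le_mul₀ h5]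
    calc 1 = c⁻¹ * c := by field_simp
      _ ≤ (c⁻¹ + |M|) * (‖riemannZeta₁ s‖ * (1 + |s.im|) ^ 8) := by
          gcongr
          linarith [abs_nonneg M]
      _ = _ := by ring
  · have h4 : ‖(riemannZeta₁ s)⁻¹‖ ≤ M := hM s ⟨⟨h1.le, h2⟩, abs_le.1 h3⟩
    have h5 : 0 < c⁻¹ := by positivity
    calc ‖(riemannZeta₁ s)⁻¹‖ ≤ |M| * 1 := by rw [mul_one]; exact h4.trans (le_abs_self M)
      _ ≤ (c⁻¹ + |M|) * (1 + |s.im|) ^ 8 := by gcongr; linarith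

/-- The coefficients `Λ(n) - 1`. -/
noncomputable def mangoldtSubOne (n : ℕ) : ℂ := (ArithmeticFunction.vonMangoldt n : ℂ) - 1

lemma lSeriesSummable_mangoldtSubOne {s : ℂ} (hs : 1 < s.re) :
    LSeriesSummable mangoldtSubOne s :=
  (ArithmeticFunction.LSeriesSummable_vonMangoldt hs).sub (LSeriesSummable_one_iff.2 hs)

lemma lSeries_mangoldtSubOne {s : ℂ} (hs : 1 < s.re) :
    LSeries mangoldtSubOne s = -(deriv riemannZeta₁ s / riemannZeta₁ s) - riemannZeta₀ s := by
  have h1 : LSeries mangoldtSubOne s = LSeries (fun n => (ArithmeticFunction.vonMangoldt n : ℂ)) s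
      - LSeries 1 s := LSeries_sub (ArithmeticFunction.LSeriesSummable_vonMangoldt hs)
        (LSeriesSummable_one_iff.2 hs)
  have hs1 : s ≠ 1 := by rintro rfl; simp at hs
  have hs1' : s - 1 ≠ 0 := sub_ne_zero.2 hs1
  have hz := riemannZeta₁_ne_zero hs.le
  rw [h1, ArithmeticFunction.LSeries_vonMangoldt_eq_deriv_riemannZeta_div hs,
    LSeries_one_eq_riemannZeta hs, deriv_riemannZeta_eq_neg_inv_sub_sq_mul_add hs1]
  nth_rewrite 2 [riemannZeta_eq_inv_sub_add hs1]
  rw [riemannZeta_eq_inv_sub_mul hs1]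
  field_simp
  ring

lemma abscissaOfAbsConv_mangoldtSubOne_le : LSeries.abscissaOfAbsConv mangoldtSubOne ≤ 1 :=
  LSeries.abscissaOfAbsConv_le_of_forall_lt_LSeriesSummable fun y hy =>
    lSeriesSummable_mangoldtSubOne (by simpa using hy)

lemma lSeriesSummable_logMul_mangoldtSubOne {s : ℂ} (hs : 1 < s.re) :
    LSeriesSummable (LSeries.logMul mangoldtSubOne) s :=
  LSeriesSummable_logMul_of_lt_re
    (abscissaOfAbsConv_mangoldtSubOne_le.trans_lt (by exact_mod_cast hs))

lemma lSeries_logMul_mangoldtSubOne {s : ℂ} (hs : 1 < s.re) :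
    LSeries (LSeries.logMul mangoldtSubOne) s =
      deriv (deriv riemannZeta₁) s * (riemannZeta₁ s)⁻¹ -
        (deriv riemannZeta₁ s * (riemannZeta₁ s)⁻¹) ^ 2 + deriv riemannZeta₀ s := by
  have h1 := LSeries_deriv (f := mangoldtSubOne) (s := s)
    (abscissaOfAbsConv_mangoldtSubOne_le.trans_lt (by exact_mod_cast hs))
  have hz := riemannZeta₁_ne_zero hs.le
  have hev : LSeries mangoldtSubOne =ᶠ[nhds s]
      fun s => -(deriv riemannZeta₁ s / riemannZeta₁ s) - riemannZeta₀ s := by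
    filter_upwards [(isOpen_lt continuous_const Complex.continuous_re).mem_nhds hs] with w hw
    exact lSeries_mangoldtSubOne hw
  have hd : HasDerivAt (fun s => -(deriv riemannZeta₁ s / riemannZeta₁ s) - riemannZeta₀ s)
      (-((deriv (deriv riemannZeta₁) s * riemannZeta₁ s -
        deriv riemannZeta₁ s * deriv riemannZeta₁ s) / riemannZeta₁ s ^ 2) -
        deriv riemannZeta₀ s) s :=
    (((differentiable_riemannZeta₁.deriv s).hasDerivAt.div
      (differentiable_riemannZeta₁ s).hasDerivAt hz).neg).sub
      (differentiable_riemannZeta₀ s).hasDerivAt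
  rw [hev.deriv_eq, hd.deriv] at h1
  rw [← neg_eq_iff_eq_neg.2 h1]
  field_simp
  ring

lemma exists_norm_lSeries_logMul_mangoldtSubOne_le :
    ∃ A : ℝ, 0 < A ∧ ∀ s : ℂ, 1 < s.re → s.re ≤ 2 →
      ‖LSeries (LSeries.logMul mangoldtSubOne) s‖ ≤ A * (1 + |s.im|) ^ 20 := by
  obtain ⟨A, hA, h0⟩ := stripBound_riemannZeta₀.deriv differentiable_riemannZeta₀
    (r := 1/4) (by norm_num)
  have hB := stripBound_riemannZeta₁.deriv differentiable_riemannZeta₁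
    (r := 1/4) (by norm_num)
  obtain ⟨D, hD, h2⟩ := hB.deriv differentiable_riemannZeta₁.deriv (r := 1/4) (by norm_num)
  obtain ⟨B, hB, h1⟩ := hB
  obtain ⟨E, hE, h3⟩ := exists_norm_inv_riemannZeta₁_le
  refine ⟨D * E + (B * E) ^ 2 + A, by positivity, fun s hs hs2 => ?_⟩
  have k0 := h0 s (by linarith) (by linarith)
  have k1 := h1 s (by linarith) (by linarith)
  have k2 := h2 s (by linarith) (by linarith)
  have k3 := h3 s hs hs2
  rw [lSeries_logMul_mangoldtSubOne hs]
  set τ := 1 + |s.im| with hτ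
  have hτ1 : 1 ≤ τ := by linarith [abs_nonneg s.im]
  calc _ ≤ ‖deriv (deriv riemannZeta₁) s‖ * ‖(riemannZeta₁ s)⁻¹‖ +
        (‖deriv riemannZeta₁ s‖ * ‖(riemannZeta₁ s)⁻¹‖) ^ 2 + ‖deriv riemannZeta₀ s‖ := by
        refine (norm_add_le _ _).trans ?_
        gcongr
        refine (norm_sub_le _ _).trans ?_
        rw [norm_pow, norm_mul, norm_mul]
    _ ≤ (D * τ ^ 2) * (E * τ ^ 8) + ((B * τ ^ 2) * (E * τ ^ 8)) ^ 2 + A * τ ^ 1 := by gcongr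
    _ = D * E * τ ^ 10 + (B * E) ^ 2 * τ ^ 20 + A * τ ^ 1 := by ring
    _ ≤ D * E * τ ^ 20 + (B * E) ^ 2 * τ ^ 20 + A * τ ^ 20 := by
        gcongr <;> first | exact hτ1 | norm_num
    _ = _ := by ring

lemma norm_Gamma_le {s : ℂ} (hs : 0 < s.re) : ‖Complex.Gamma s‖ ≤ Real.Gamma s.re := by
  rw [Complex.Gamma_eq_integral hs, Real.Gamma_eq_integral hs, Complex.GammaIntegral]
  refine MeasureTheory.norm_integral_le_of_norm_le (Real.GammaIntegral_convergent hs) ?_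
  refine (MeasureTheory.ae_restrict_iff' measurableSet_Ioi).2 (Filter.Eventually.of_forall ?_)
  intro t ht
  rw [norm_mul, Complex.norm_real, Real.norm_of_nonneg (Real.exp_nonneg _),
    Complex.norm_cpow_eq_rpow_re_of_pos ht]
  simp

lemma norm_Gamma_mul_pow_le (k : ℕ) {s : ℂ} (hs : 1 ≤ s.re) :
    ‖Complex.Gamma s‖ * (1 + |s.im|) ^ k ≤ 2 ^ k * Real.Gamma (s.re + k) := by
  induction k generalizing s with
  | zero =>
    have h0 : 0 < s.re := by linarith
    simp only [pow_zero, mul_one, one_mul, CharP.cast_eq_zero, add_zero]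
    exact norm_Gamma_le h0
  | succ k ih =>
    have h1 := ih (s := s + 1) (by simp; linarith)
    have hs0 : s ≠ 0 := by rintro rfl; simp at hs; linarith
    rw [Complex.Gamma_add_one s hs0, norm_mul] at h1
    simp only [Complex.add_im, Complex.one_im, add_zero, Complex.add_re, Complex.one_re] at h1
    have h2 : 1 + |s.im| ≤ 2 * ‖s‖ := by
      have := Complex.abs_im_le_norm s
      have := (le_abs_self _).trans (Complex.abs_re_le_norm s)
      linarith
    calc ‖Complex.Gamma s‖ * (1 + |s.im|) ^ (k + 1)
        = (1 + |s.im|) * (‖Complex.Gamma s‖ * (1 + |s.im|) ^ k) := by ring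
      _ ≤ (2 * ‖s‖) * (‖Complex.Gamma s‖ * (1 + |s.im|) ^ k) := by gcongr
      _ = 2 * (‖s‖ * ‖Complex.Gamma s‖ * (1 + |s.im|) ^ k) := by ring
      _ ≤ 2 * (2 ^ k * Real.Gamma (s.re + 1 + k)) := by gcongr
      _ = _ := by push_cast; rw [show s.re + 1 + k = s.re + (k + 1) by ring]; ring

lemma norm_Gamma_mul_pow_le_of_re_le_two {s : ℂ} (hs : 1 ≤ s.re) (hs2 : s.re ≤ 2) :
    ‖Complex.Gamma s‖ * (1 + |s.im|) ^ 22 ≤ 2 ^ 22 * Real.Gamma 24 := by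
  refine (norm_Gamma_mul_pow_le 22 hs).trans ?_
  gcongr
  refine Real.Gamma_strictMonoOn_Ici.monotoneOn ?_ ?_ ?_ <;> norm_num <;> linarith

lemma one_add_sq_le_one_add_abs_sq (t : ℝ) : 1 + t ^ 2 ≤ (1 + |t|) ^ 2 := by
  nlinarith [abs_nonneg t, sq_abs t]

lemma integrable_Gamma_vertical {σ : ℝ} (h1 : 1 ≤ σ) (h2 : σ ≤ 2) :
    MeasureTheory.Integrable (fun t : ℝ => Complex.Gamma (σ + t * Complex.I)) := by
  have hc : Continuous (fun t : ℝ => Complex.Gamma (σ + t * Complex.I)) := by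
    refine continuous_iff_continuousAt.2 fun t => ?_
    have : ContinuousAt Complex.Gamma (σ + t * Complex.I) :=
      (Complex.differentiableAt_Gamma _ fun m hm => by
        have := congrArg Complex.re hm
        simp at this
        have : (0 : ℝ) ≤ m := by positivity
        linarith).continuousAt
    exact ContinuousAt.comp (f := fun t : ℝ => (σ + t * Complex.I : ℂ)) this (by fun_prop)
  refine (integrable_inv_one_add_sq.const_mul (2 ^ 22 * Real.Gamma 24)).mono'
    hc.aestronglyMeasurable (Filter.Eventually.of_forall fun t => ?_)
  have h := norm_Gamma_mul_pow_le_of_re_le_two (s := σ + t * Complex.I) (by simpa) (by simpa)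
  have him : (σ + t * Complex.I : ℂ).im = t := by simp
  rw [him] at h
  have hτ : 1 ≤ 1 + |t| := by linarith [abs_nonneg t]
  calc ‖Complex.Gamma (σ + t * Complex.I)‖
      = ‖Complex.Gamma (σ + t * Complex.I)‖ * (1 + |t|) ^ 2 * ((1 + |t|) ^ 2)⁻¹ := by
        field_simp
    _ ≤ ‖Complex.Gamma (σ + t * Complex.I)‖ * (1 + |t|) ^ 22 * ((1 + |t|) ^ 2)⁻¹ := by
        gcongr <;> first | exact hτ | norm_num
    _ ≤ 2 ^ 22 * Real.Gamma 24 * (1 + t ^ 2)⁻¹ := by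
        gcongr
        exact one_add_sq_le_one_add_abs_sq t

lemma exp_neg_eq_integral_Gamma {σ : ℝ} (h1 : 1 ≤ σ) (h2 : σ ≤ 2) {y : ℝ} (hy : 0 < y) :
    ∫ t : ℝ, (y : ℂ) ^ (-(σ + t * Complex.I)) * Complex.Gamma (σ + t * Complex.I) =
      2 * Real.pi * (Real.exp (-y) : ℂ) := by
  have hre : ∀ t : ℝ, 0 < (σ + t * Complex.I : ℂ).re := fun t => by simp; linarith
  have hG : ∀ t : ℝ, mellin (fun x : ℝ => (Real.exp (-x) : ℂ)) (σ + t * Complex.I) =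
      Complex.Gamma (σ + t * Complex.I) := fun t => by
    rw [Complex.Gamma_eq_integral (hre t), Complex.GammaIntegral_eq_mellin]
  have h := mellinInv_mellin_eq σ (fun x : ℝ => (Real.exp (-x) : ℂ)) hy ?_ ?_ ?_
  · rw [mellinInv] at h
    simp only [hG, smul_eq_mul] at h
    rw [← h, Complex.real_smul]
    have : (Real.pi : ℂ) ≠ 0 := by exact_mod_cast Real.pi_ne_zero
    generalize (∫ t : ℝ, (y : ℂ) ^ (-(σ + t * Complex.I)) *
      Complex.Gamma (σ + t * Complex.I)) = J
    push_cast
    field_simp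
  · have := Complex.GammaIntegral_convergent (s := σ) (by simp; linarith)
    refine this.congr_fun (fun t _ => ?_) measurableSet_Ioi
    simp only [smul_eq_mul]
    rw [mul_comm]
  · have := integrable_Gamma_vertical h1 h2
    refine this.congr (Filter.Eventually.of_forall fun t => ?_)
    exact (hG t).symm
  · fun_prop

lemma hasSum_integral_lSeries_mul_Gamma {f : ℕ → ℂ} (hf : f 0 = 0) {σ : ℝ} (h1 : 1 ≤ σ)
    (h2 : σ ≤ 2) (hs : LSeriesSummable f σ) {x : ℝ} (hx : 0 < x) :
    HasSum (fun n : ℕ => 2 * Real.pi * (f n * (Real.exp (-(n / x)) : ℂ)))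
      (∫ t : ℝ, LSeries f (σ + t * Complex.I) *
        ((x : ℂ) ^ (σ + t * Complex.I) * Complex.Gamma (σ + t * Complex.I))) := by
  let F : ℕ → ℝ → ℂ := fun n t => LSeries.term f (σ + t * Complex.I) n *
        ((x : ℂ) ^ (σ + t * Complex.I) * Complex.Gamma (σ + t * Complex.I))
  have hxc : (x : ℂ) ≠ 0 := by exact_mod_cast hx.ne'
  have hG := integrable_Gamma_vertical h1 h2
  have hF0 : ∀ t, F 0 t = 0 := fun t => by simp [F]
  have hFn : ∀ n : ℕ, n ≠ 0 → ∀ t : ℝ, F n t = f n * (((n / x : ℝ) : ℂ) ^ (-(σ + t * Complex.I)) *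
      Complex.Gamma (σ + t * Complex.I)) := by
    intro n hn t
    simp only [F, LSeries.term_of_ne_zero hn]
    have hn0 : (0 : ℝ) < n := by exact_mod_cast Nat.pos_of_ne_zero hn
    have : ((n / x : ℝ) : ℂ) = (n : ℝ) * ((x⁻¹ : ℝ) : ℂ) := by push_cast; rw [div_eq_mul_inv]
    rw [this, Complex.mul_cpow_ofReal_nonneg hn0.le (by positivity), Complex.ofReal_inv,
      Complex.inv_cpow _ _ (by rw [Complex.arg_ofReal_of_nonneg hx.le]; exact Real.pi_pos.ne),
      Complex.cpow_neg, Complex.cpow_neg, inv_inv, Complex.ofReal_natCast]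
    ring
  have hint : ∀ n : ℕ, MeasureTheory.Integrable (F n) := by
    intro n
    rcases eq_or_ne n 0 with rfl | hn
    · simp_rw [funext hF0]; exact MeasureTheory.integrable_zero _ _ _
    · have hn0 : (0 : ℝ) < n / x := by
        have : (0 : ℝ) < n := by exact_mod_cast Nat.pos_of_ne_zero hn
        positivity
      rw [funext (hFn n hn)]
      refine MeasureTheory.Integrable.const_mul ?_ _
      refine hG.bdd_mul (c := (n / x) ^ (-σ)) ?_ (Filter.Eventually.of_forall fun t => ?_)
      · have hc : ((n / x : ℝ) : ℂ) ≠ 0 := by exact_mod_cast hn0.ne'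
        refine Continuous.aestronglyMeasurable ?_
        exact Continuous.const_cpow (by fun_prop) (Or.inl hc)
      · rw [Complex.norm_cpow_eq_rpow_re_of_pos hn0]
        simp
  have hnorm : ∀ n t, ‖F n t‖ = ‖LSeries.term f σ n‖ *
      (x ^ σ * ‖Complex.Gamma (σ + t * Complex.I)‖) := by
    intro n t
    simp only [F, norm_mul, Complex.norm_cpow_eq_rpow_re_of_pos hx]
    congr 1
    · rw [LSeries.norm_term_eq, LSeries.norm_term_eq]; simp
    · simp
  have hsum : Summable fun n => ∫ t, ‖F n t‖ := by
    simp_rw [hnorm, MeasureTheory.integral_const_mul]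
    exact hs.norm.mul_right _
  have := MeasureTheory.hasSum_integral_of_summable_integral_norm hint hsum
  have hl : (fun n : ℕ => 2 * Real.pi * (f n * (Real.exp (-(n / x)) : ℂ))) =
      fun n => ∫ t, F n t := by
    funext n
    rcases eq_or_ne n 0 with rfl | hn
    · simp [hf, hF0]
    · have hn0 : (0 : ℝ) < n / x := by
        have : (0 : ℝ) < n := by exact_mod_cast Nat.pos_of_ne_zero hn
        positivity
      rw [funext (hFn n hn), MeasureTheory.integral_const_mul,
        exp_neg_eq_integral_Gamma h1 h2 hn0]
      ring
  have hr : (fun t : ℝ => LSeries f (σ + t * Complex.I) *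
        ((x : ℂ) ^ (σ + t * Complex.I) * Complex.Gamma (σ + t * Complex.I))) =
      fun t => ∑' n, F n t := by
    funext t
    rw [LSeries, ← tsum_mul_right]
  rw [hl, hr]
  exact this

lemma exists_norm_tsum_logMul_mangoldtSubOne_le :
    ∃ K : ℝ, 0 < K ∧ ∀ x : ℝ, Real.exp 1 ≤ x →
      Summable (fun n : ℕ => LSeries.logMul mangoldtSubOne n * (Real.exp (-(n / x)) : ℂ)) ∧
      ‖∑' n : ℕ, LSeries.logMul mangoldtSubOne n * (Real.exp (-(n / x)) : ℂ)‖ ≤ K * x := by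
  obtain ⟨A, hA, h⟩ := exists_norm_lSeries_logMul_mangoldtSubOne_le
  have hΓ : 0 < Real.Gamma 24 := Real.Gamma_pos_of_pos (by norm_num)
  set G : ℝ := 2 ^ 22 * Real.Gamma 24 with hG
  have hG0 : 0 < G := by positivity
  refine ⟨A * G * Real.exp 1, by positivity, fun x hx => ?_⟩
  have hx0 : 0 < x := (Real.exp_pos 1).trans_le hx
  have hl : 1 ≤ Real.log x := by rwa [Real.le_log_iff_exp_le hx0]
  have hl0 : 0 < Real.log x := by linarith
  set σ : ℝ := 1 + 1 / Real.log x with hσ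
  have hσ1 : 1 < σ := by rw [hσ]; linarith [one_div_pos.2 hl0]
  have hσ2 : σ ≤ 2 := by
    have : 1 / Real.log x ≤ 1 := by rw [div_le_one hl0]; exact hl
    linarith
  have hxσ : x ^ σ = x * Real.exp 1 := by
    rw [hσ, Real.rpow_add hx0, Real.rpow_one, Real.rpow_def_of_pos hx0]
    congr 2
    field_simp
  have hS := hasSum_integral_lSeries_mul_Gamma (f := LSeries.logMul mangoldtSubOne)
    (by simp [LSeries.logMul]) hσ1.le hσ2
    (lSeriesSummable_logMul_mangoldtSubOne (by simpa using hσ1)) hx0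
  have hpi : (2 * Real.pi : ℂ) ≠ 0 := by
    simp [Real.pi_ne_zero]
  have hS2 := hS.mul_left ((2 * Real.pi : ℂ)⁻¹)
  simp only [inv_mul_cancel_left₀ hpi] at hS2
  refine ⟨hS2.summable, ?_⟩
  rw [hS2.tsum_eq, norm_mul]
  have hb : ‖∫ t : ℝ, LSeries (LSeries.logMul mangoldtSubOne) (σ + t * Complex.I) *
        ((x : ℂ) ^ (σ + t * Complex.I) * Complex.Gamma (σ + t * Complex.I))‖ ≤
      ∫ t : ℝ, A * G * (x * Real.exp 1) * (1 + t ^ 2)⁻¹ := by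
    refine MeasureTheory.norm_integral_le_of_norm_le
      (integrable_inv_one_add_sq.const_mul _) (Filter.Eventually.of_forall fun t => ?_)
    have hre : (σ + t * Complex.I : ℂ).re = σ := by simp
    have him : (σ + t * Complex.I : ℂ).im = t := by simp
    have b1 := h (σ + t * Complex.I) (by rwa [hre]) (by rwa [hre])
    have b2 := norm_Gamma_mul_pow_le_of_re_le_two (s := σ + t * Complex.I)
      (by rw [hre]; exact hσ1.le) (by rwa [hre])
    rw [him] at b1 b2
    rw [norm_mul, norm_mul, Complex.norm_cpow_eq_rpow_re_of_pos hx0, hre, hxσ]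
    have hτ : 0 < 1 + |t| := by linarith [abs_nonneg t]
    calc _ ≤ A * (1 + |t|) ^ 20 * (x * Real.exp 1 * ‖Complex.Gamma (σ + t * Complex.I)‖) := by
          gcongr
      _ = A * (x * Real.exp 1) * (‖Complex.Gamma (σ + t * Complex.I)‖ * (1 + |t|) ^ 22) *
          ((1 + |t|) ^ 2)⁻¹ := by field_simp
      _ ≤ A * (x * Real.exp 1) * G * (1 + t ^ 2)⁻¹ := by
          gcongr
          exact one_add_sq_le_one_add_abs_sq t
      _ = _ := by ring
  rw [MeasureTheory.integral_const_mul, integral_univ_inv_one_add_sq] at hb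
  calc _ ≤ ‖(2 * Real.pi : ℂ)⁻¹‖ * (A * G * (x * Real.exp 1) * Real.pi) := by gcongr
    _ = (A * G * Real.exp 1 * x) / 2 := by
        have : ‖(2 * Real.pi : ℂ)‖ = 2 * Real.pi := by
          simp [abs_of_pos Real.pi_pos]
        rw [norm_inv, this]
        field_simp
    _ ≤ _ := by
        have : 0 < A * G * Real.exp 1 * x := by positivity
        linarith

lemma hasSum_exp_neg_div {x : ℝ} (hx : 0 < x) :
    HasSum (fun n : ℕ => Real.exp (-(n / x))) (1 - Real.exp (-(1 / x)))⁻¹ := by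
  have h : Real.exp (-(1 / x)) < 1 := by
    rw [Real.exp_lt_one_iff]
    have := one_div_pos.2 hx
    linarith
  convert hasSum_geometric_of_lt_one (Real.exp_nonneg _) h using 2 with n
  rw [← Real.exp_nat_mul]
  congr 1
  ring

lemma le_inv_one_sub_exp_neg {x : ℝ} (hx : 0 < x) : x ≤ (1 - Real.exp (-(1 / x)))⁻¹ := by
  have h : Real.exp (-(1 / x)) < 1 := by
    rw [Real.exp_lt_one_iff]
    have := one_div_pos.2 hx
    linarith
  rw [le_inv_comm₀ hx (by linarith), ← one_div]
  linarith [Real.add_one_le_exp (-(1 / x))]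

lemma inv_one_sub_exp_neg_le {x : ℝ} (hx : 0 < x) :
    (1 - Real.exp (-(1 / x)))⁻¹ ≤ x + 1 := by
  have hx' := one_div_pos.2 hx
  have h2 : Real.exp (-(1 / x)) ≤ x / (x + 1) := by
    rw [Real.exp_neg, inv_le_comm₀ (Real.exp_pos _) (by positivity), inv_div]
    have := Real.add_one_le_exp (1 / x)
    have h3 : (x + 1) / x = 1 / x + 1 := by field_simp; ring
    rwa [h3]
  have h4 : x / (x + 1) = 1 - (x + 1)⁻¹ := by field_simp; ring
  rw [h4] at h2
  exact inv_le_of_inv_le₀ (by positivity) (by linarith)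

lemma sum_range_log_eq_log_factorial (M : ℕ) :
    ∑ n ∈ range (M + 1), Real.log n = Real.log M.factorial := by
  induction M with
  | zero => simp
  | succ M ih =>
    rw [sum_range_succ, ih, Nat.factorial_succ, Nat.cast_mul, Real.log_mul
      (by positivity) (by positivity), add_comm]

lemma sum_range_log_sub_log_le {x : ℝ} (hx : 0 < x) (M : ℕ) :
    ∑ n ∈ range (M + 1), (Real.log x - Real.log n) ≤ x + Real.log x := by
  rw [sum_sub_distrib, sum_range_log_eq_log_factorial]
  have h := Real.log_le_log (by positivity) (Real.pow_div_factorial_le_exp x hx.le M)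
  rw [Real.log_exp, Real.log_div (by positivity) (by positivity), Real.log_pow] at h
  simp only [sum_const, card_range, nsmul_eq_mul, Nat.cast_add, Nat.cast_one]
  linarith

lemma abs_log_sub_log_mul_exp_le {x : ℝ} (hx : 1 ≤ x) (n : ℕ) :
    |Real.log n - Real.log x| * Real.exp (-(n / x)) ≤ 2 * Real.exp (-(n / (2 * x))) +
      if n ∈ range (⌊x⌋₊ + 1) then Real.log x - Real.log n else 0 := by
  have hx0 : 0 < x := by linarith
  have hmem : n ∈ range (⌊x⌋₊ + 1) ↔ (n : ℝ) ≤ x := by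
    rw [mem_range, Nat.lt_add_one_iff, Nat.le_floor_iff hx0.le]
  split_ifs with h
  · rw [hmem] at h
    have h1 : 0 ≤ Real.log x - Real.log n := by
      rcases Nat.eq_zero_or_pos n with rfl | hn
      · simpa using Real.log_nonneg hx
      · have : (0 : ℝ) < n := by exact_mod_cast hn
        linarith [Real.log_le_log this h]
    have h2 : Real.exp (-(n / x)) ≤ 1 := by
      rw [Real.exp_le_one_iff]
      have : 0 ≤ n / x := by positivity
      linarith
    rw [abs_sub_comm, abs_of_nonneg h1]
    have := mul_le_mul_of_nonneg_left h2 h1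
    linarith [Real.exp_pos (-(n / (2 * x)))]
  · rw [hmem, not_le] at h
    have hn : (0 : ℝ) < n := by linarith
    have h1 : 0 ≤ Real.log n - Real.log x := by linarith [Real.log_le_log hx0 h.le]
    rw [abs_of_nonneg h1, ← Real.log_div hn.ne' hx0.ne', add_zero]
    have h2 : Real.log (n / x) ≤ n / x := Real.log_le_self (by positivity)
    have h3 : n / x ≤ 2 * Real.exp (n / (2 * x)) := by
      have := Real.add_one_le_exp (n / (2 * x))
      have e : n / x = 2 * (n / (2 * x)) := by field_simp
      linarith
    have h4 : Real.exp (-(n / x)) = Real.exp (-(n / (2 * x))) * Real.exp (-(n / (2 * x))) := by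
      rw [← Real.exp_add]; congr 1; field_simp; ring
    calc _ ≤ 2 * Real.exp (n / (2 * x)) * Real.exp (-(n / x)) := by gcongr; linarith
      _ = 2 * (Real.exp (n / (2 * x)) * Real.exp (-(n / (2 * x)))) *
          Real.exp (-(n / (2 * x))) := by rw [h4]; ring
      _ = _ := by rw [← Real.exp_add]; simp

lemma summable_log_mul_exp_and_abs_tsum_sub_le {x : ℝ} (hx : 1 ≤ x) :
    Summable (fun n : ℕ => Real.log n * Real.exp (-(n / x))) ∧
      |∑' n : ℕ, Real.log n * Real.exp (-(n / x)) - x * Real.log x| ≤ 9 * x := by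
  have hx0 : 0 < x := by linarith
  have hlx : Real.log x ≤ x := Real.log_le_self hx0.le
  have hlx0 := Real.log_nonneg hx
  have h1 := hasSum_exp_neg_div hx0
  have h2 := (hasSum_exp_neg_div (x := 2 * x) (by positivity)).mul_left 2
  have h3 : HasSum (fun n => if n ∈ range (⌊x⌋₊ + 1) then Real.log x - Real.log n else 0)
      (∑ n ∈ range (⌊x⌋₊ + 1), (Real.log x - Real.log n)) := by
    have := hasSum_sum_of_ne_finset_zero (f := fun n : ℕ => if n ∈ range (⌊x⌋₊ + 1) then
      Real.log x - Real.log n else 0) (L := .unconditional ℕ) (fun n hn => if_neg hn)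
    rwa [sum_congr rfl fun n hn => if_pos hn] at this
  have h4 := h2.add h3
  have hd : Summable (fun n : ℕ => (Real.log n - Real.log x) * Real.exp (-(n / x))) := by
    refine h4.summable.of_norm_bounded fun n => ?_
    rw [norm_mul, Real.norm_eq_abs, Real.norm_of_nonneg (Real.exp_nonneg _)]
    exact abs_log_sub_log_mul_exp_le hx n
  have hdb := tsum_of_norm_bounded (f := fun n : ℕ => (Real.log n - Real.log x) *
    Real.exp (-(n / x))) h4 fun n => by
      rw [norm_mul, Real.norm_eq_abs, Real.norm_of_nonneg (Real.exp_nonneg _)]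
      exact abs_log_sub_log_mul_exp_le hx n
  have h5 := hd.hasSum.add (h1.mul_left (Real.log x))
  have e : (fun n : ℕ => (Real.log n - Real.log x) * Real.exp (-(n / x)) +
      Real.log x * Real.exp (-(n / x))) = fun n : ℕ => Real.log n * Real.exp (-(n / x)) := by
    funext n; ring
  rw [e] at h5
  refine ⟨h5.summable, ?_⟩
  rw [h5.tsum_eq]
  have b1 := inv_one_sub_exp_neg_le (x := 2 * x) (by positivity)
  have b2 := inv_one_sub_exp_neg_le hx0
  have b3 := le_inv_one_sub_exp_neg hx0
  have b4 := sum_range_log_sub_log_le hx0 ⌊x⌋₊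
  have b5 := mul_le_mul_of_nonneg_left b2 hlx0
  have b6 := mul_le_mul_of_nonneg_left b3 hlx0
  rw [Real.norm_eq_abs] at hdb
  rw [abs_le] at hdb ⊢
  constructor <;> linarith [hdb.1, hdb.2]

lemma log_sq_div_sq_le (n : ℕ) : Real.log n ^ 2 / (n : ℝ) ^ 2 ≤ 16 * (n : ℝ) ^ (-(3 / 2) : ℝ) := by
  rcases Nat.eq_zero_or_pos n with rfl | hn
  · simp
  · have hn0 : (0 : ℝ) < n := by exact_mod_cast hn
    have h := Real.log_le_rpow_div hn0.le (ε := 1 / 4) (by norm_num)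
    have h0 : 0 ≤ Real.log n := Real.log_natCast_nonneg n
    calc Real.log n ^ 2 / (n : ℝ) ^ 2 ≤ ((n : ℝ) ^ (1 / 4 : ℝ) / (1 / 4)) ^ 2 / (n : ℝ) ^ 2 := by
          gcongr
      _ = 16 * ((n : ℝ) ^ (1 / 4 : ℝ) * (n : ℝ) ^ (1 / 4 : ℝ) / (n : ℝ) ^ (2 : ℝ)) := by
          rw [Real.rpow_two]; ring
      _ = _ := by
          rw [← Real.rpow_add hn0, ← Real.rpow_sub hn0]
          norm_num

lemma summable_log_sq_div_sq : Summable fun n : ℕ => Real.log n ^ 2 / (n : ℝ) ^ 2 :=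
  ((Real.summable_nat_rpow.2 (by norm_num)).mul_left 16).of_nonneg_of_le
    (fun n => by positivity) log_sq_div_sq_le

lemma vonMangoldt_mul_log_sub_nonneg (n : ℕ) :
    0 ≤ ArithmeticFunction.vonMangoldt n * (Real.log n - ArithmeticFunction.vonMangoldt n) :=
  mul_nonneg ArithmeticFunction.vonMangoldt_nonneg
    (sub_nonneg.2 ArithmeticFunction.vonMangoldt_le_log)

lemma primes_pow_succ_injective :
    Function.Injective fun q : Nat.Primes × ℕ => (q.1 : ℕ) ^ (q.2 + 1) :=
  Subtype.val_injective.comp Nat.Primes.prodNatEquiv.injective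

lemma exists_primes_pow_succ_eq {n : ℕ} (h : IsPrimePow n) :
    ∃ q : Nat.Primes × ℕ, (q.1 : ℕ) ^ (q.2 + 1) = n := by
  obtain ⟨p, k, hp, hk, rfl⟩ := h
  exact ⟨(⟨p, hp.nat_prime⟩, k - 1), by simp [Nat.sub_add_cancel hk]⟩

lemma vonMangoldt_mul_log_sub_div_prime_pow_le {p : ℕ} (hp : p.Prime) (k : ℕ) :
    ArithmeticFunction.vonMangoldt (p ^ (k + 1)) * (Real.log ((p ^ (k + 1) : ℕ) : ℝ) -
      ArithmeticFunction.vonMangoldt (p ^ (k + 1))) / ((p ^ (k + 1) : ℕ) : ℝ) ≤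
      Real.log p ^ 2 / (p : ℝ) ^ 2 * (2 * ((k : ℝ) ^ 1 * (1 / 2) ^ k)) := by
  rw [ArithmeticFunction.vonMangoldt_apply_pow k.succ_ne_zero,
    ArithmeticFunction.vonMangoldt_apply_prime hp, Nat.cast_pow, Real.log_pow, pow_one]
  have hp2 : (2 : ℝ) ≤ p := by exact_mod_cast hp.two_le
  rcases k with _ | k
  · simp
  · have hk : (2 : ℝ) ^ k ≤ (p : ℝ) ^ k := by gcongr
    have hp0 : (0 : ℝ) < p := by linarith
    calc _ = Real.log p ^ 2 / (p : ℝ) ^ 2 * ((k + 1) * ((p : ℝ) ^ k)⁻¹) := by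
          push_cast; field_simp; ring
      _ ≤ Real.log p ^ 2 / (p : ℝ) ^ 2 * ((k + 1) * ((2 : ℝ) ^ k)⁻¹) := by gcongr
      _ = _ := by push_cast; rw [one_div, inv_pow]; field_simp; ring

lemma summable_vonMangoldt_mul_log_sub_div : Summable fun n : ℕ =>
    ArithmeticFunction.vonMangoldt n * (Real.log n - ArithmeticFunction.vonMangoldt n) / n := by
  set f : ℕ → ℝ := fun n =>
    ArithmeticFunction.vonMangoldt n * (Real.log n - ArithmeticFunction.vonMangoldt n) / n with hf
  refine (primes_pow_succ_injective.summable_iff fun n hn => ?_).1 ?_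
  · have : ArithmeticFunction.vonMangoldt n = 0 := by
      rw [ArithmeticFunction.vonMangoldt_eq_zero_iff]
      exact fun h => hn (exists_primes_pow_succ_eq h)
    simp [hf, this]
  have h1 : Summable fun k : ℕ => 2 * ((k : ℝ) ^ 1 * (1 / 2) ^ k) :=
    Summable.mul_left 2
      (summable_pow_mul_geometric_of_norm_lt_one 1 (r := (1 / 2 : ℝ)) (by norm_num))
  have h2 : Summable fun p : Nat.Primes => Real.log (p : ℕ) ^ 2 / ((p : ℕ) : ℝ) ^ 2 :=
    summable_log_sq_div_sq.comp_injective Nat.Primes.coe_nat_injective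
  have h3 := h2.mul_of_nonneg h1 (fun p => by positivity) (fun k => by positivity)
  refine h3.of_nonneg_of_le (fun q => ?_) fun q => ?_
  · exact div_nonneg (vonMangoldt_mul_log_sub_nonneg _) (Nat.cast_nonneg _)
  · exact vonMangoldt_mul_log_sub_div_prime_pow_le q.1.2 q.2

lemma vonMangoldt_mul_log_sub_mul_exp_le {x : ℝ} (hx : 0 < x) (n : ℕ) :
    ArithmeticFunction.vonMangoldt n * (Real.log n - ArithmeticFunction.vonMangoldt n) *
      Real.exp (-(n / x)) ≤
      x * (ArithmeticFunction.vonMangoldt n *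
        (Real.log n - ArithmeticFunction.vonMangoldt n) / n) := by
  rcases Nat.eq_zero_or_pos n with rfl | hn
  · simp
  · have hn0 : (0 : ℝ) < n := by exact_mod_cast hn
    have h : Real.exp (-(n / x)) ≤ x / n := by
      rw [Real.exp_neg, inv_le_comm₀ (Real.exp_pos _) (by positivity), inv_div]
      linarith [Real.add_one_le_exp (n / x)]
    calc _ ≤ _ := mul_le_mul_of_nonneg_left h (vonMangoldt_mul_log_sub_nonneg n)
      _ = _ := by ring

lemma exists_abs_tsum_vonMangoldt_sq_mul_exp_sub_le :
    ∃ K : ℝ, 0 < K ∧ ∀ x : ℝ, Real.exp 1 ≤ x →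
      |∑' n : ℕ, ArithmeticFunction.vonMangoldt n ^ 2 * Real.exp (-(n / x)) - x * Real.log x| ≤
        K * x := by
  obtain ⟨K, hK, h⟩ := exists_norm_tsum_logMul_mangoldtSubOne_le
  have hT := summable_vonMangoldt_mul_log_sub_div
  set T := ∑' n : ℕ,
    ArithmeticFunction.vonMangoldt n * (Real.log n - ArithmeticFunction.vonMangoldt n) / n
  have hT0 : 0 ≤ T := tsum_nonneg fun n =>
    div_nonneg (vonMangoldt_mul_log_sub_nonneg n) (Nat.cast_nonneg n)
  refine ⟨K + 9 + T, by positivity, fun x hx => ?_⟩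
  have hx1 : 1 ≤ x := by linarith [Real.add_one_le_exp 1]
  have hx0 : 0 < x := by linarith
  obtain ⟨s1, b1⟩ := h x hx
  obtain ⟨s2, b2⟩ := summable_log_mul_exp_and_abs_tsum_sub_le hx1
  have e1 : (fun n : ℕ => LSeries.logMul mangoldtSubOne n * (Real.exp (-(n / x)) : ℂ)) =
      fun n : ℕ => ((Real.log n * (ArithmeticFunction.vonMangoldt n - 1) *
        Real.exp (-(n / x)) : ℝ) : ℂ) := by
    funext n
    simp only [LSeries.logMul, mangoldtSubOne]
    push_cast
    rfl
  rw [e1] at s1 b1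
  rw [← Complex.ofReal_tsum, Complex.norm_real, Real.norm_eq_abs] at b1
  replace s1 := Complex.summable_ofReal.1 s1
  have h3 := vonMangoldt_mul_log_sub_mul_exp_le hx0
  have h30 : ∀ n : ℕ, 0 ≤ ArithmeticFunction.vonMangoldt n *
      (Real.log n - ArithmeticFunction.vonMangoldt n) * Real.exp (-(n / x)) := fun n =>
    mul_nonneg (vonMangoldt_mul_log_sub_nonneg n) (Real.exp_nonneg _)
  have s3 := (hT.mul_left x).of_nonneg_of_le h30 h3
  have b3 := s3.tsum_le_tsum h3 (hT.mul_left x)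
  rw [tsum_mul_left] at b3
  have b30 := tsum_nonneg (L := .unconditional ℕ) h30
  have hs := (s1.hasSum.add s2.hasSum).sub s3.hasSum
  have e2 : (fun n : ℕ => Real.log n * (ArithmeticFunction.vonMangoldt n - 1) *
        Real.exp (-(n / x)) + Real.log n * Real.exp (-(n / x)) -
        ArithmeticFunction.vonMangoldt n * (Real.log n - ArithmeticFunction.vonMangoldt n) *
          Real.exp (-(n / x))) =
      fun n : ℕ => ArithmeticFunction.vonMangoldt n ^ 2 * Real.exp (-(n / x)) := by
    funext n; ring
  rw [e2] at hs
  rw [hs.tsum_eq]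
  rw [abs_le] at b1 b2 ⊢
  constructor <;> linarith [b1.1, b1.2, b2.1, b2.2]

lemma integral_exp_mul_conj_exp (n m : ℕ) :
    ∫ α in (-(1/2 : ℝ))..(1/2 : ℝ), Complex.exp (2 * (Real.pi : ℂ) * Complex.I * n * α) *
      (starRingEnd ℂ) (Complex.exp (2 * (Real.pi : ℂ) * Complex.I * m * α)) =
      if m = n then 1 else 0 := by
  have h : ∀ α : ℝ, Complex.exp (2 * (Real.pi : ℂ) * Complex.I * n * α) *
      (starRingEnd ℂ) (Complex.exp (2 * (Real.pi : ℂ) * Complex.I * m * α)) =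
      Complex.exp (2 * (Real.pi : ℂ) * Complex.I * ((n : ℂ) - m) * α) := by
    intro α
    rw [← Complex.exp_conj, ← Complex.exp_add]
    simp only [map_mul, Complex.conj_ofReal, Complex.conj_I, map_natCast, map_ofNat]
    congr 1
    ring
  simp_rw [h]
  split_ifs with hmn
  · subst hmn
    simp
    norm_num
  · have hc : (2 * (Real.pi : ℂ) * Complex.I * ((n : ℂ) - m)) ≠ 0 := by
      refine mul_ne_zero Complex.two_pi_I_ne_zero (sub_ne_zero.2 ?_)
      exact_mod_cast Ne.symm hmn
    rw [integral_exp_mul_complex hc, div_eq_zero_iff, sub_eq_zero]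
    left
    rw [Complex.exp_eq_exp_iff_exists_int]
    refine ⟨(n : ℤ) - m, ?_⟩
    push_cast
    ring

lemma norm_exp_two_pi_I_mul (n : ℕ) (α : ℝ) :
    ‖Complex.exp (2 * (Real.pi : ℂ) * Complex.I * n * α)‖ = 1 := by
  rw [Complex.norm_exp]
  simp

lemma continuous_tsum_mul_exp {c : ℕ → ℂ} (hc : Summable fun n => ‖c n‖) :
    Continuous fun α : ℝ => ∑' n : ℕ, c n * Complex.exp (2 * (Real.pi : ℂ) * Complex.I * n * α) := by
  refine continuous_tsum (fun n => by fun_prop) hc fun n α => ?_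
  rw [norm_mul, norm_exp_two_pi_I_mul, mul_one]

lemma integral_norm_sq_tsum_mul_exp {c : ℕ → ℂ} (hc : Summable fun n => ‖c n‖) :
    ∫ α in (-(1/2 : ℝ))..(1/2 : ℝ),
      ‖∑' n : ℕ, c n * Complex.exp (2 * (Real.pi : ℂ) * Complex.I * n * α)‖ ^ 2 =
      ∑' n, ‖c n‖ ^ 2 := by
  set e : ℕ → ℝ → ℂ := fun n α => Complex.exp (2 * (Real.pi : ℂ) * Complex.I * n * α) with he
  have hec : ∀ n, Continuous (e n) := fun n => by fun_prop
  have hen : ∀ n α, ‖e n α‖ = 1 := norm_exp_two_pi_I_mul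
  set f : ℝ → ℂ := fun α => ∑' n : ℕ, c n * e n α with hf
  have hfc : Continuous f := continuous_tsum_mul_exp hc
  have hs : ∀ α, Summable fun n => c n * e n α := fun α =>
    Summable.of_norm (by simpa [hen] using hc)
  have hfb : ∀ α, ‖f α‖ ≤ ∑' n, ‖c n‖ := fun α =>
    tsum_of_norm_bounded hc.hasSum fun n => by rw [norm_mul, hen, mul_one]
  have h1 : ∀ n, ∫ α in (-(1/2 : ℝ))..(1/2 : ℝ), e n α * (starRingEnd ℂ) (f α) =
      (starRingEnd ℂ) (c n) := by
    intro n
    have := intervalIntegral.hasSum_integral_of_dominated_convergence (μ := MeasureTheory.volume)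
      (a := -(1/2 : ℝ)) (b := 1/2)
      (F := fun m α => (starRingEnd ℂ) (c m) * (e n α * (starRingEnd ℂ) (e m α)))
      (f := fun α => e n α * (starRingEnd ℂ) (f α))
      (fun m _ => ‖c m‖)
      (fun m => (Continuous.aestronglyMeasurable (by
        have := hec m; have := hec n; fun_prop)))
      (fun m => Filter.Eventually.of_forall fun α _ => by
        simp [hen])
      (Filter.Eventually.of_forall fun α _ => hc)
      (by simp)
      (Filter.Eventually.of_forall fun α _ => by
        have h := (Complex.hasSum_conj'.2 (hs α).hasSum).mul_left (e n α)
        have h5 : (fun m => (starRingEnd ℂ) (c m) * (e n α * (starRingEnd ℂ) (e m α))) =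
            fun m => e n α * (starRingEnd ℂ) (c m * e m α) := by
          funext m
          rw [map_mul]
          ring
        rw [h5]
        exact h)
    simp only [intervalIntegral.integral_const_mul] at this
    have h2 := fun m => integral_exp_mul_conj_exp n m
    simp only [he] at this
    simp only [h2] at this
    refine this.unique ?_
    have h4 : (fun m => (starRingEnd ℂ) (c m) * if m = n then 1 else 0) =
        fun m => if m = n then (starRingEnd ℂ) (c n) else 0 := by
      funext m
      split_ifs with h <;> simp [h]
    rw [h4]
    exact hasSum_ite_eq n _
  have h3 := intervalIntegral.hasSum_integral_of_dominated_convergence (μ := MeasureTheory.volume)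
      (a := -(1/2 : ℝ)) (b := 1/2)
      (F := fun n α => c n * (e n α * (starRingEnd ℂ) (f α)))
      (f := fun α => f α * (starRingEnd ℂ) (f α))
      (fun n _ => ‖c n‖ * ∑' m, ‖c m‖)
      (fun m => (Continuous.aestronglyMeasurable (by
        have := hec m; fun_prop)))
      (fun m => Filter.Eventually.of_forall fun α _ => by
        have := hfb α
        simp only [norm_mul, hen, one_mul, RCLike.norm_conj]
        gcongr)
      (Filter.Eventually.of_forall fun α _ => hc.mul_right _)
      (by simp)
      (Filter.Eventually.of_forall fun α _ => by
        simpa only [mul_assoc] using (hs α).hasSum.mul_right ((starRingEnd ℂ) (f α)))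
  simp only [intervalIntegral.integral_const_mul, h1, Complex.mul_conj', ← Complex.ofReal_pow,
    intervalIntegral.integral_ofReal] at h3
  exact (Complex.hasSum_ofReal.1 h3).tsum_eq.symm

lemma summable_norm_vM_mul_exp {N : ℕ} (hN : 1 ≤ N) :
    Summable fun n : ℕ => ‖(vM n : ℂ) * Real.exp (-(n : ℝ) / N)‖ := by
  refine (summable_log_mul_exp_and_abs_tsum_sub_le
    (x := N) (by exact_mod_cast hN)).1.of_nonneg_of_le (fun n => norm_nonneg _) fun n => ?_
  rw [norm_mul, Complex.norm_real, Complex.norm_real, Real.norm_of_nonneg (Real.exp_nonneg _),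
    vM, Real.norm_of_nonneg ArithmeticFunction.vonMangoldt_nonneg, neg_div]
  gcongr
  exact ArithmeticFunction.vonMangoldt_le_log

lemma continuous_Stilde {N : ℕ} (hN : 1 ≤ N) : Continuous (Stilde N) :=
  continuous_tsum_mul_exp (summable_norm_vM_mul_exp hN)

lemma integral_norm_sq_Stilde {N : ℕ} (hN : 1 ≤ N) :
    ∫ α in (-(1/2 : ℝ))..(1/2 : ℝ), ‖Stilde N α‖ ^ 2 =
      ∑' n : ℕ, ArithmeticFunction.vonMangoldt n ^ 2 * Real.exp (-(n / ((N : ℝ) / 2))) := by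
  refine (integral_norm_sq_tsum_mul_exp (summable_norm_vM_mul_exp hN)).trans ?_
  congr 1
  funext n
  rw [norm_mul, Complex.norm_real, Complex.norm_real, Real.norm_of_nonneg (Real.exp_nonneg _),
    vM, Real.norm_of_nonneg ArithmeticFunction.vonMangoldt_nonneg, mul_pow, ← Real.exp_nat_mul]
  congr 2
  push_cast
  field_simp

lemma zOf_ne_zero {N : ℕ} (hN : 1 ≤ N) (α : ℝ) : zOf N α ≠ 0 := by
  intro h
  have := congrArg Complex.re h
  have hN0 : (N : ℝ) ≠ 0 := by positivity
  simp [zOf] at this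
  omega

lemma continuous_one_div_zOf {N : ℕ} (hN : 1 ≤ N) : Continuous fun α => 1 / zOf N α := by
  refine continuous_const.div ?_ (zOf_ne_zero hN)
  unfold zOf
  fun_prop

lemma norm_sq_one_div_zOf {N : ℕ} (hN : 1 ≤ N) (α : ℝ) :
    ‖1 / zOf N α‖ ^ 2 = N ^ 2 * (1 + (2 * Real.pi * N * α) ^ 2)⁻¹ := by
  have hN0 : (N : ℝ) ≠ 0 := by positivity
  have hre : (zOf N α).re = 1 / N := by simp [zOf]
  have him : (zOf N α).im = -(2 * Real.pi * α) := by simp [zOf]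
  rw [norm_div, norm_one, div_pow, ← Complex.normSq_eq_norm_sq, Complex.normSq_apply, hre, him]
  field_simp

lemma integral_norm_sq_one_div_zOf_le {N : ℕ} (hN : 1 ≤ N) :
    ∫ α in (-(1/2 : ℝ))..(1/2 : ℝ), ‖1 / zOf N α‖ ^ 2 ≤ N / 2 := by
  have hN0 : (0 : ℝ) < N := by exact_mod_cast hN
  have hpi := Real.pi_pos
  simp_rw [norm_sq_one_div_zOf hN]
  rw [intervalIntegral.integral_const_mul, intervalIntegral.integral_comp_mul_left
    (fun y => (1 + y ^ 2)⁻¹) (by positivity), integral_inv_one_add_sq, smul_eq_mul]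
  have h1 := Real.arctan_lt_pi_div_two (2 * Real.pi * N * (1 / 2))
  have h2 := Real.neg_pi_div_two_lt_arctan (2 * Real.pi * N * -(1 / 2))
  calc _ ≤ (N : ℝ) ^ 2 * ((2 * Real.pi * N)⁻¹ * Real.pi) := by gcongr; linarith
    _ = _ := by field_simp

lemma abs_norm_sub_sq_sub_norm_sq_le (a b : ℂ) {l : ℝ} (hl : 0 < l) :
    |‖a - b‖ ^ 2 - ‖a‖ ^ 2| ≤ l * ‖a‖ ^ 2 + (l⁻¹ + 1) * ‖b‖ ^ 2 := by
  have h1 : ‖a - b‖ ≤ ‖a‖ + ‖b‖ := norm_sub_le a b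
  have h2 : ‖a‖ ≤ ‖a - b‖ + ‖b‖ := by simpa using norm_add_le (a - b) b
  have hA := norm_nonneg a
  have hB := norm_nonneg b
  have hC := norm_nonneg (a - b)
  have h3 : 2 * ‖a‖ * ‖b‖ ≤ l * ‖a‖ ^ 2 + l⁻¹ * ‖b‖ ^ 2 := by
    have : 0 ≤ l⁻¹ * (l * ‖a‖ - ‖b‖) ^ 2 := by positivity
    have e : l⁻¹ * (l * ‖a‖ - ‖b‖) ^ 2 = l * ‖a‖ ^ 2 + l⁻¹ * ‖b‖ ^ 2 - 2 * ‖a‖ * ‖b‖ := by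
      field_simp; ring
    linarith
  rw [abs_le]
  constructor
  · rcases le_total ‖a‖ ‖b‖ with h | h <;> nlinarith
  · nlinarith

lemma abs_integral_norm_sub_sq_sub_le {f g : ℝ → ℂ} (hf : Continuous f) (hg : Continuous g)
    {a b : ℝ} (hab : a ≤ b) {l : ℝ} (hl : 0 < l) :
    |(∫ t in a..b, ‖f t - g t‖ ^ 2) - ∫ t in a..b, ‖f t‖ ^ 2| ≤
      l * (∫ t in a..b, ‖f t‖ ^ 2) + (l⁻¹ + 1) * ∫ t in a..b, ‖g t‖ ^ 2 := by
  have i1 : IntervalIntegrable (fun t => ‖f t - g t‖ ^ 2) MeasureTheory.volume a b :=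
    Continuous.intervalIntegrable (by fun_prop) _ _
  have i2 : IntervalIntegrable (fun t => ‖f t‖ ^ 2) MeasureTheory.volume a b :=
    Continuous.intervalIntegrable (by fun_prop) _ _
  have i3 : IntervalIntegrable (fun t => ‖g t‖ ^ 2) MeasureTheory.volume a b :=
    Continuous.intervalIntegrable (by fun_prop) _ _
  rw [← intervalIntegral.integral_sub i1 i2, ← intervalIntegral.integral_const_mul,
    ← intervalIntegral.integral_const_mul,
    ← intervalIntegral.integral_add (i2.const_mul _) (i3.const_mul _)]
  refine (intervalIntegral.abs_integral_le_integral_abs hab).trans ?_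
  exact intervalIntegral.integral_mono_on hab (i1.sub i2).abs
    ((i2.const_mul _).add (i3.const_mul _)) fun t _ => abs_norm_sub_sq_sub_norm_sq_le _ _ hl

theorem Stilde_unconditional_mean_square :
    ∃ C : ℝ, 0 < C ∧ ∃ N₀ : ℕ, ∀ N : ℕ, N₀ ≤ N →
      |(∫ α in (-(1/2 : ℝ))..(1/2 : ℝ), ‖Stilde N α - 1 / zOf N α‖ ^ 2) -
        (N : ℝ) / 2 * Real.log N| ≤ C * N * Real.sqrt (Real.log N) := by
  obtain ⟨K, hK, h⟩ := exists_abs_tsum_vonMangoldt_sq_mul_exp_sub_le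
  refine ⟨2 * K + 3, by positivity, 6, fun N hN => ?_⟩
  have hN1 : 1 ≤ N := by omega
  have hN6 : (6 : ℝ) ≤ N := by exact_mod_cast hN
  have hN0 : (0 : ℝ) < N := by linarith
  have he : Real.exp 1 ≤ 3 := by linarith [Real.exp_one_lt_d9]
  have hL1 : 1 ≤ Real.log N := by
    rw [Real.le_log_iff_exp_le hN0]
    linarith
  set L := Real.sqrt (Real.log N) with hL
  have hLL : L * L = Real.log N := Real.mul_self_sqrt (by linarith)
  have hL1' : 1 ≤ L := Real.one_le_sqrt.2 hL1
  have hA := h (N / 2) (by linarith)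
  rw [← integral_norm_sq_Stilde hN1, Real.log_div hN0.ne' two_ne_zero] at hA
  have hl2 : Real.log 2 ≤ 1 := by linarith [Real.log_two_lt_d9]
  have hl2' : 0 ≤ Real.log 2 := Real.log_nonneg one_le_two
  have hB := integral_norm_sq_one_div_zOf_le hN1
  have hD := abs_integral_norm_sub_sq_sub_le (continuous_Stilde hN1) (continuous_one_div_zOf hN1)
    (a := -(1 / 2)) (b := 1 / 2) (by norm_num) (l := L⁻¹) (by positivity)
  rw [inv_inv] at hD
  set A := ∫ α in (-(1/2 : ℝ))..(1/2 : ℝ), ‖Stilde N α‖ ^ 2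
  set B := ∫ α in (-(1/2 : ℝ))..(1/2 : ℝ), ‖1 / zOf N α‖ ^ 2
  have hL0 : 0 < L := by linarith
  have hA' : |A - N / 2 * Real.log N| ≤ (K + 1) * (N / 2) := by
    rw [abs_le] at hA ⊢
    constructor <;> nlinarith [hA.1, hA.2]
  have hAu : A ≤ (K + 2) * (N / 2) * (L * L) := by
    rw [abs_le] at hA'
    have : (K + 1) * (N / 2) * 1 ≤ (K + 1) * (N / 2) * (L * L) := by
      gcongr; linarith
    rw [← hLL] at hA'
    linarith [hA'.2]
  have t1 : L⁻¹ * A ≤ (K + 2) * (N / 2) * L := by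
    calc L⁻¹ * A ≤ L⁻¹ * ((K + 2) * (N / 2) * (L * L)) := by gcongr
      _ = _ := by field_simp
  have t2 : (L + 1) * B ≤ 2 * L * (N / 2) :=
    calc (L + 1) * B ≤ (L + 1) * (N / 2) := by gcongr
      _ ≤ 2 * L * (N / 2) := by gcongr; linarith
  have t3 : (K + 1) * (N / 2) * 1 ≤ (K + 1) * (N / 2) * L := by gcongr
  have t4 := abs_sub_le (∫ α in (-(1/2 : ℝ))..(1/2 : ℝ), ‖Stilde N α - 1 / zOf N α‖ ^ 2) A
    (N / 2 * Real.log N)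
  have t5 : 0 ≤ K * N * L := by positivity
  have t6 : 0 ≤ N * L := by positivity
  linarith
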